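/- Suppose the monomial weight x^A is partial, i.e., α_i = 0 for at least one index i (say α_N = 0). Then the Poincaré inequality ∫_{ℝ^N_*} |∇u|² dμ_A ≥ ∫_{ℝ^N_*} |u − ∫_{ℝ^N_*} u dμ_A|² dμ_A is attained with equality by non-constant functions; in particular, every function of the form u(x) = a + Σ_{j : α_j = 0} a_j x_j (with some a_j ≠ 0) is non-constant and satisfies ∫_{ℝ^N_*} |∇u|² dμ_A = ∫_{ℝ^N_*} |u − ∫_{ℝ^N_*} u dμ_A|² dμ_A = Σ_{j : α_j = 0} a_j². -/

import Mathlib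

open MeasureTheory Real

noncomputable section

/-- The Weyl chamber associated to the monomial weight with exponents `α`. -/
def chamber {N : ℕ} (α : Fin N → ℝ) : Set (EuclideanSpace ℝ (Fin N)) :=
  {x | ∀ i, 0 < α i → 0 < x i}

/-- The monomial weight `x^A = x₁^{α₁} ⋯ x_N^{α_N}`. -/
def monWeight {N : ℕ} (α : Fin N → ℝ) (x : EuclideanSpace ℝ (Fin N)) : ℝ :=
  ∏ i, x i ^ α i

/-- The monomial Gaussian probability measure
`dμ_A = x^A e^{-|x|²/2} dx / ∫_{ℝ^N_*} x^A e^{-|x|²/2} dx` on the Weyl chamber. -/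
def monGauss {N : ℕ} (α : Fin N → ℝ) : Measure (EuclideanSpace ℝ (Fin N)) :=
  (((MeasureTheory.volume.restrict (chamber α)).withDensity
      (fun x => ENNReal.ofReal (monWeight α x * Real.exp (-‖x‖ ^ 2 / 2)))) Set.univ)⁻¹ •
  ((MeasureTheory.volume.restrict (chamber α)).withDensity
      (fun x => ENNReal.ofReal (monWeight α x * Real.exp (-‖x‖ ^ 2 / 2))))

/-- Membership in the class `N_*`: smooth, compactly supported, with vanishing normal
component of the gradient on the boundary of the Weyl chamber. -/
def NstarClass {N : ℕ} (α : Fin N → ℝ) (u : EuclideanSpace ℝ (Fin N) → ℝ) : Prop :=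
  ContDiff ℝ (⊤ : ℕ∞) u ∧ HasCompactSupport u ∧
    ∀ x : EuclideanSpace ℝ (Fin N), ∀ i, 0 < α i → x i = 0 →
      fderiv ℝ u x (EuclideanSpace.single i 1) = 0

end

/-- A finite product of measures with integrable nonnegative densities has the product density. -/
lemma pi_withDensity_ofReal {ι : Type*} [Fintype ι] {X : ι → Type*}
    {mX : ∀ i, MeasurableSpace (X i)} (μ : ∀ i, Measure (X i)) [∀ i, SigmaFinite (μ i)]
    {f : ∀ i, X i → ℝ} (hf : ∀ i, Integrable (f i) (μ i)) (hf0 : ∀ i t, 0 ≤ f i t) :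
    Measure.pi (fun i => (μ i).withDensity fun t => ENNReal.ofReal (f i t)) =
      (Measure.pi μ).withDensity fun x => ENNReal.ofReal (∏ i, f i (x i)) := by
  have hfin : ∀ i, IsFiniteMeasure ((μ i).withDensity fun t => ENNReal.ofReal (f i t)) :=
    fun i => isFiniteMeasure_withDensity_ofReal (hf i).2
  refine Measure.pi_eq fun s hs => ?_
  rw [withDensity_apply _ (MeasurableSet.univ_pi hs), Measure.restrict_pi_pi,
    ← ofReal_integral_eq_lintegral_ofReal
      (Integrable.fintype_prod_dep fun i => (hf i).integrableOn)
      (ae_of_all _ fun x => Finset.prod_nonneg fun i _ => hf0 i _),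
    integral_fintype_prod_eq_prod,
    ENNReal.ofReal_prod_of_nonneg fun i _ => integral_nonneg (hf0 i)]
  refine Finset.prod_congr rfl fun i _ => ?_
  rw [withDensity_apply _ (hs i),
    ofReal_integral_eq_lintegral_ofReal (hf i).integrableOn (ae_of_all _ (hf0 i))]

/-- Normalising each factor of a finite product of finite measures normalises the product. -/
lemma pi_normalize {ι : Type*} [Fintype ι] {X : ι → Type*}
    {mX : ∀ i, MeasurableSpace (X i)} (μ : ∀ i, Measure (X i)) [∀ i, IsFiniteMeasure (μ i)]
    [∀ i, NeZero (μ i)] :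
    Measure.pi (fun i => (μ i Set.univ)⁻¹ • μ i) =
      (Measure.pi μ Set.univ)⁻¹ • Measure.pi μ := by
  refine Measure.pi_eq fun s _ => ?_
  simp only [Measure.smul_apply, smul_eq_mul, Measure.pi_pi, Measure.pi_univ,
    Finset.prod_mul_distrib]
  rw [ENNReal.prod_inv_distrib]
  exact fun i _ j _ _ => Or.inr (measure_ne_top _ _)

/-- The one-dimensional factor of the monomial Gaussian density. -/
noncomputable def monDensity (a t : ℝ) : ℝ :=
  {t : ℝ | 0 < a → 0 < t}.indicator (fun t => t ^ a * Real.exp (-t ^ 2 / 2)) t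

lemma monDensity_of_imp {a t : ℝ} (h : 0 < a → 0 < t) :
    monDensity a t = t ^ a * Real.exp (-t ^ 2 / 2) := by
  rw [monDensity, Set.indicator_of_mem (by simpa using h)]

lemma monDensity_of_not_imp {a t : ℝ} (h : ¬(0 < a → 0 < t)) : monDensity a t = 0 := by
  rw [monDensity, Set.indicator_of_notMem (by simpa using h)]

lemma monDensity_nonneg {a : ℝ} (ha : 0 ≤ a) (t : ℝ) : 0 ≤ monDensity a t := by
  refine Set.indicator_nonneg (fun t ht => mul_nonneg ?_ (exp_pos _).le) t
  rcases ha.eq_or_lt with rfl | h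
  · simp
  · exact rpow_nonneg (ht h).le a

lemma monDensity_pos {a t : ℝ} (ht : 0 < t) : 0 < monDensity a t := by
  rw [monDensity_of_imp fun _ => ht]
  positivity

lemma integrable_monDensity {a : ℝ} (ha : 0 ≤ a) : Integrable (monDensity a) := by
  have h := integrable_rpow_mul_exp_neg_mul_sq (b := 1 / 2) (by norm_num) (s := a) (by linarith)
  have h' : Integrable fun t : ℝ => t ^ a * Real.exp (-t ^ 2 / 2) := by
    convert h using 4
    ring
  refine h'.indicator ?_
  by_cases h0 : 0 < a
  · simp only [h0, forall_const]
    exact measurableSet_lt measurable_const measurable_id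
  · simp [h0]

/-- The unnormalised one-dimensional monomial Gaussian measure. -/
noncomputable def monFactor (a : ℝ) : Measure ℝ :=
  volume.withDensity fun t => ENNReal.ofReal (monDensity a t)

lemma isFiniteMeasure_monFactor {a : ℝ} (ha : 0 ≤ a) : IsFiniteMeasure (monFactor a) :=
  isFiniteMeasure_withDensity_ofReal (integrable_monDensity ha).2

lemma neZero_monFactor {a : ℝ} (ha : 0 ≤ a) : NeZero (monFactor a) := by
  refine ⟨fun h => ?_⟩
  have h0 := (withDensity_eq_zero_iff
    (integrable_monDensity ha).aestronglyMeasurable.aemeasurable.ennreal_ofReal).1 h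
  have h1 : volume (Set.Ioi (0 : ℝ)) = 0 :=
    measure_mono_null (fun t ht => by simpa using monDensity_pos ht) (ae_iff.1 h0)
  simp at h1

lemma monFactor_zero_normalize :
    (monFactor 0 Set.univ)⁻¹ • monFactor 0 = ProbabilityTheory.gaussianReal 0 1 := by
  have h : ProbabilityTheory.gaussianReal 0 1 =
      ENNReal.ofReal (√(2 * π))⁻¹ • monFactor 0 := by
    rw [ProbabilityTheory.gaussianReal_of_var_ne_zero _ one_ne_zero, monFactor,
      ← withDensity_smul' _ _ ENNReal.ofReal_ne_top]
    congr 1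
    ext t
    simp only [ProbabilityTheory.gaussianPDF, ProbabilityTheory.gaussianPDFReal, monDensity,
      Pi.smul_apply, smul_eq_mul]
    rw [← ENNReal.ofReal_mul (by positivity)]
    simp
  have h1 : ENNReal.ofReal (√(2 * π))⁻¹ * monFactor 0 Set.univ = 1 := by
    simpa [h] using measure_univ (μ := ProbabilityTheory.gaussianReal 0 1)
  rw [h, ENNReal.eq_inv_of_mul_eq_one_left h1]

lemma indicator_chamber {N : ℕ} {α : Fin N → ℝ}
    (x : EuclideanSpace ℝ (Fin N)) :
    (chamber α).indicator
      (fun x => ENNReal.ofReal (monWeight α x * Real.exp (-‖x‖ ^ 2 / 2))) x =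
      ENNReal.ofReal (∏ i, monDensity (α i) (x i)) := by
  by_cases hx : x ∈ chamber α
  · rw [Set.indicator_of_mem hx]
    have (i : Fin N) : monDensity (α i) (x i) = x i ^ α i * Real.exp (-(x i) ^ 2 / 2) :=
      monDensity_of_imp (hx i)
    simp_rw [this, Finset.prod_mul_distrib, ← Real.exp_sum, monWeight,
      EuclideanSpace.real_norm_sq_eq, ← Finset.sum_div, Finset.sum_neg_distrib]
  · rw [Set.indicator_of_notMem hx]
    obtain ⟨i, hi⟩ := not_forall.1 hx
    rw [Finset.prod_eq_zero (Finset.mem_univ i) (monDensity_of_not_imp hi),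
      ENNReal.ofReal_zero]

lemma measurableSet_chamber {N : ℕ} (α : Fin N → ℝ) : MeasurableSet (chamber α) := by
  simp only [chamber, Set.ofPred_forall]
  exact .iInter fun i => .iInter fun _ => measurableSet_lt measurable_const (by fun_prop)

/-- The monomial Gaussian measure is the product of its normalised one-dimensional factors. -/
lemma measurePreserving_ofLp_monGauss {N : ℕ} {α : Fin N → ℝ} (hα : ∀ i, 0 ≤ α i) :
    MeasurePreserving (MeasurableEquiv.toLp 2 (Fin N → ℝ)).symm (monGauss α)
      (Measure.pi fun i => (monFactor (α i) Set.univ)⁻¹ • monFactor (α i)) := by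
  have := fun i => isFiniteMeasure_monFactor (hα i)
  have := fun i => neZero_monFactor (hα i)
  have key : MeasurePreserving (MeasurableEquiv.toLp 2 (Fin N → ℝ)).symm
      ((volume.restrict (chamber α)).withDensity
        fun x => ENNReal.ofReal (monWeight α x * Real.exp (-‖x‖ ^ 2 / 2)))
      (Measure.pi fun i => monFactor (α i)) := by
    refine ⟨(MeasurableEquiv.toLp 2 (Fin N → ℝ)).symm.measurable, ?_⟩
    ext s hs
    rw [← withDensity_indicator (measurableSet_chamber α), funext indicator_chamber,
      (MeasurableEquiv.toLp 2 (Fin N → ℝ)).symm.map_apply,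
      withDensity_apply _ ((MeasurableEquiv.toLp 2 (Fin N → ℝ)).symm.measurable hs)]
    unfold monFactor
    rw [pi_withDensity_ofReal _ (fun i => integrable_monDensity (hα i))
        (fun i => monDensity_nonneg (hα i)), withDensity_apply _ hs, ← volume_pi]
    exact (PiLp.volume_preserving_ofLp (Fin N)).setLIntegral_comp_preimage_emb
      (MeasurableEquiv.toLp 2 (Fin N → ℝ)).symm.measurableEmbedding
      (fun y => ENNReal.ofReal (∏ i, monDensity (α i) (y i))) s
  refine ⟨key.measurable, ?_⟩
  rw [pi_normalize, monGauss, Measure.map_smul, ← key.map_eq,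
    Measure.map_apply key.measurable .univ, Set.preimage_univ]

lemma gradient_affine {N : ℕ} (a : ℝ) (b : Fin N → ℝ) (x : EuclideanSpace ℝ (Fin N)) :
    gradient (fun x : EuclideanSpace ℝ (Fin N) => a + ∑ j, b j * x j) x = WithLp.toLp 2 b := by
  refine HasGradientAt.gradient ?_
  have h := ((InnerProductSpace.toDual ℝ (EuclideanSpace ℝ (Fin N))
    (WithLp.toLp 2 b)).hasFDerivAt (x := x)).const_add a
  rw [hasGradientAt_iff_hasFDerivAt]
  refine h.congr_of_eventuallyEq (.of_forall fun y => ?_)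
  simp [PiLp.inner_apply, mul_comm]

/-- If the monomial weight is partial, the Poincaré inequality with monomial Gaussian
weight is attained with equality by the non-constant functions
`u(x) = a + Σ_{j : α_j = 0} a_j x_j`, both sides being `Σ_{j : α_j = 0} a_j²`. -/
theorem poincare_monomial_gaussian_attained {N : ℕ} (hN : 1 ≤ N) (α : Fin N → ℝ)
    (hα : ∀ i, 0 ≤ α i) (hpartial : ∃ i, α i = 0) (a : ℝ) (aj : Fin N → ℝ)
    (hsupp : ∀ j, α j ≠ 0 → aj j = 0) (hne : ∃ j, α j = 0 ∧ aj j ≠ 0) :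
    let u : EuclideanSpace ℝ (Fin N) → ℝ := fun x => a + ∑ j, aj j * x j
    (∃ x y, u x ≠ u y) ∧
    (∫ x, ‖gradient u x‖ ^ 2 ∂(monGauss α)) = ∑ j, (aj j) ^ 2 ∧
    (∫ x, (u x - ∫ y, u y ∂(monGauss α)) ^ 2 ∂(monGauss α)) = ∑ j, (aj j) ^ 2 := by
  intro u
  have := fun i => isFiniteMeasure_monFactor (hα i)
  have := fun i => neZero_monFactor (hα i)
  have hmp := measurePreserving_ofLp_monGauss hα
  set ν : Fin N → Measure ℝ := fun i => (monFactor (α i) Set.univ)⁻¹ • monFactor (α i)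
  have : ∀ i, IsProbabilityMeasure (ν i) := fun i => isProbabilityMeasureSMul
  have : IsProbabilityMeasure (monGauss α) := by
    rw [isProbabilityMeasure_iff]
    simpa using hmp.measure_preimage_equiv Set.univ
  have hν : ∀ i, α i = 0 → ν i = ProbabilityTheory.gaussianReal 0 1 := fun i hi => by
    simp only [ν, hi, monFactor_zero_normalize]
  refine ⟨?_, ?_, ?_⟩
  · obtain ⟨j, -, hj⟩ := hne
    refine ⟨EuclideanSpace.single j 1, 0, ?_⟩
    simpa [u, Pi.single_apply] using hj
  · simp [u, gradient_affine, EuclideanSpace.real_norm_sq_eq]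
  · have hmem : ∀ j, MemLp (fun t : ℝ => aj j * t) 2 (ν j) := fun j => by
      by_cases hj : α j = 0
      · rw [hν j hj]
        exact (ProbabilityTheory.memLp_id_gaussianReal 2).const_mul (aj j)
      · simp [hsupp j hj]
    have hvar : ∀ j, ProbabilityTheory.variance (fun t : ℝ => aj j * t) (ν j) = aj j ^ 2 :=
      fun j => by
        rw [ProbabilityTheory.variance_const_mul]
        by_cases hj : α j = 0
        · simp [hν j hj, ProbabilityTheory.variance_fun_id_gaussianReal]
        · simp [hsupp j hj]
    have hu : Measurable u := by fun_prop
    rw [← ProbabilityTheory.variance_eq_integral hu.aemeasurable,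
      ProbabilityTheory.variance_const_add (by fun_prop), ← Finset.sum_congr rfl fun j _ => hvar j,
      ← ProbabilityTheory.variance_sum_pi hmem, ← hmp.map_eq,
      ProbabilityTheory.variance_map (by fun_prop) hmp.measurable.aemeasurable]
    congr 1
    ext x
    simp
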